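/- arXiv:1105.2426 — 3 statements merged into one kernel-verified Lean document; each statement's English description precedes it below -/
import Mathlib

section
/- Let k be a finite field and let A = ⊕_{n≥0} A_n be a commutative ℕ-graded k-algebra with A_0 = k (the degree-zero piece is the k-span of 1) which is finitely generated as a k-algebra. Then every graded k-algebra automorphism φ of A (i.e., a k-algebra automorphism satisfying φ(A_n) = A_n for all n) has finite order: there exists an integer m ≥ 1 such that φ^m is the identity. -/
namespace GradedAlgebra

/-- In an ℕ-graded algebra of finite type over a finite degree-zero piece, every homogeneous
component is finite. -/
theorem finite_component {k A : Type*} [CommRing k] [CommRing A] [Algebra k A]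
    (𝒜 : ℕ → Submodule k A) [GradedAlgebra 𝒜] [Finite (𝒜 0)] [Algebra.FiniteType (𝒜 0) A]
    (n : ℕ) : Finite (𝒜 n) := by
  obtain ⟨s, hs, hdeg⟩ := exists_finset_adjoin_eq_top_and_homogeneous_ne_zero 𝒜
  choose! w hw hmem using hdeg
  let T : Set A := (fun d : s →₀ ℕ ↦ ∏ i : s, (i : A) ^ d i) ''
    {d | Finsupp.weight (fun i : s ↦ w i) d = n}
  have hT : T.Finite :=
    (Finsupp.finite_of_nat_weight_eq (fun i : s ↦ w i) (fun i ↦ hw i i.2) n).image _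
  have hspan (x : A) :
      (DirectSum.decompose 𝒜 x n : A) ∈ Submodule.span (𝒜 0) T := by
    have hx : x ∈ Submodule.span (𝒜 0) (Submonoid.closure (Set.range ((↑) : s → A)) : Set A) := by
      rw [← Algebra.adjoin_eq_span, Subtype.range_coe_subtype]
      exact hs.ge (Algebra.mem_top (R := 𝒜 0))
    induction hx using Submodule.span_induction with
    | mem x hx =>
      obtain ⟨d, rfl⟩ := Submonoid.exists_of_mem_closure_range _ _ hx
      have hd : ∏ i : s, (i : A) ^ d i ∈ 𝒜 (∑ i : s, d i • w i) :=
        SetLike.prod_pow_mem_graded _ _ _ _ fun i _ ↦ hmem i i.2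
      by_cases H : ∑ i : s, d i • w i = n
      · rw [DirectSum.decompose_of_mem_same 𝒜 (H ▸ hd)]
        refine Submodule.subset_span ⟨Finsupp.equivFunOnFinite.symm d, ?_, by simp⟩
        simpa [Finsupp.weight_apply, Finsupp.sum_fintype] using H
      · rw [DirectSum.decompose_of_mem_ne 𝒜 hd H]
        exact zero_mem _
    | zero => simp
    | add x y _ _ hx hy => simpa using add_mem hx hy
    | smul r x _ hx =>
      rw [Algebra.smul_def, show algebraMap (𝒜 0) A r = (r : A) from rfl,
        DirectSum.coe_decompose_mul_of_left_mem_zero 𝒜 r.2]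
      exact Submodule.smul_mem _ r hx
  have : Module.Finite (𝒜 0) (Submodule.span (𝒜 0) T) := Module.Finite.span_of_finite _ hT
  have : Finite (Submodule.span (𝒜 0) T) := Module.finite_of_finite (𝒜 0)
  refine Set.Finite.subset (Set.toFinite (Submodule.span (𝒜 0) T : Set A)) fun x hx ↦ ?_
  simpa [DirectSum.decompose_of_mem_same 𝒜 hx] using hspan x

end GradedAlgebra

/-- An additive endomorphism that is injective and preserves finite homogeneous components
has only periodic points. -/
theorem DirectSum.Decomposition.mem_periodicPts {ι k A : Type*} [DecidableEq ι] [Semiring k]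
    [AddCommMonoid A] [Module k A] (𝒜 : ι → Submodule k A) [DirectSum.Decomposition 𝒜]
    [∀ i, Finite (𝒜 i)] (f : A →ₗ[k] A) (hf : Function.Injective f)
    (hmaps : ∀ i, Set.MapsTo f (𝒜 i) (𝒜 i)) (x : A) : x ∈ Function.periodicPts f := by
  induction x using DirectSum.Decomposition.inductionOn 𝒜 with
  | zero => exact Function.mk_mem_periodicPts one_pos (map_zero f)
  | @homogeneous i x =>
    have hinj : Function.Injective (hmaps i).restrict := (hmaps i).restrict_inj.2 hf.injOn
    exact Function.Semiconj.mapsTo_periodicPts (g := Subtype.val) (fun _ ↦ rfl)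
      (hinj.mem_periodicPts x)
  | add x y hx hy =>
    obtain ⟨m, hm, hx⟩ := Function.mem_periodicPts.1 hx
    obtain ⟨n, hn, hy⟩ := Function.mem_periodicPts.1 hy
    refine Function.mk_mem_periodicPts (Nat.mul_pos hm hn) ?_
    have hx' := hx.mul_const n
    have hy' := hy.const_mul m
    simp only [Function.IsPeriodicPt, Function.IsFixedPt, ← Module.End.coe_pow] at *
    rw [map_add, hx', hy']

/-- An automorphism of a finitely generated algebra all of whose points are periodic has finite
order. -/
theorem AlgEquiv.isOfFinOrder_of_forall_mem_periodicPts {k A : Type*} [CommSemiring k] [Semiring A]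
    [Algebra k A] (S : Finset A) (hS : Algebra.adjoin k (S : Set A) = ⊤) (φ : A ≃ₐ[k] A)
    (hφ : ∀ x ∈ S, x ∈ Function.periodicPts φ) : IsOfFinOrder φ := by
  refine isOfFinOrder_iff_pow_eq_one.2 ⟨∏ x ∈ S, Function.minimalPeriod φ x,
    Finset.prod_pos fun x hx ↦ Function.minimalPeriod_pos_of_mem_periodicPts (hφ x hx), ?_⟩
  refine AlgEquiv.coe_toAlgHom_injective (AlgHom.ext_of_adjoin_eq_top hS fun x hx ↦ ?_)
  have h : Function.IsPeriodicPt φ (∏ x ∈ S, Function.minimalPeriod φ x) x :=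
    Function.isPeriodicPt_iff_minimalPeriod_dvd.2 (Finset.dvd_prod_of_mem _ hx)
  simpa [Function.IsPeriodicPt, Function.IsFixedPt, ← AlgEquiv.coe_pow] using h


/-- Lemma 2.2: over a finite field `k`, any graded `k`-algebra automorphism of a
finitely generated commutative ℕ-graded `k`-algebra `A` with `A₀ = k` has finite order. -/
theorem graded_automorphism_finite_order
    (k A : Type*) [Field k] [Finite k] [CommRing A] [Algebra k A]
    (𝒜 : ℕ → Submodule k A) [GradedAlgebra 𝒜]
    (h0 : 𝒜 0 = Submodule.span k {(1 : A)})
    (hfg : ∃ S : Finset A, Algebra.adjoin k (S : Set A) = ⊤)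
    (φ : A ≃ₐ[k] A)
    (hφ : ∀ n : ℕ, Submodule.map φ.toLinearMap (𝒜 n) = 𝒜 n) :
    ∃ m : ℕ, 1 ≤ m ∧ φ ^ m = 1 := by
  obtain ⟨S, hS⟩ := hfg
  have : Finite (𝒜 0) := by
    rw [h0]
    exact Module.finite_of_finite k
  have : Algebra.FiniteType k A := ⟨⟨S, hS⟩⟩
  have : IsScalarTower k (𝒜 0) A := ⟨fun a b x ↦ smul_mul_assoc a (b : A) x⟩
  have : Algebra.FiniteType (𝒜 0) A := .of_restrictScalars_finiteType k (𝒜 0) A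
  have (n : ℕ) : Finite (𝒜 n) := GradedAlgebra.finite_component 𝒜 n
  have hmaps (n : ℕ) : Set.MapsTo φ.toLinearMap (𝒜 n) (𝒜 n) := fun x hx ↦
    (hφ n).le (Submodule.mem_map_of_mem hx)
  have hfin : IsOfFinOrder φ := φ.isOfFinOrder_of_forall_mem_periodicPts S hS fun x _ ↦
    DirectSum.Decomposition.mem_periodicPts 𝒜 φ.toLinearMap φ.injective hmaps x
  exact isOfFinOrder_iff_pow_eq_one.1 hfin
end

section
/- Let k be a finite field and let A = ⊕_{n≥0} A_n be a commutative ℕ-graded k-algebra with A_0 = k (the degree-zero piece is the k-span of 1) which is finitely generated as a k-algebra. Then the set of graded k-algebra automorphisms of A (k-algebra automorphisms φ with φ(A_n) = A_n for all n) is finite. -/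
open MvPolynomial in
/-- Evaluating at homogeneous elements intertwines the weighted homogeneous components of a
polynomial with the homogeneous components of its value. -/
theorem GradedAlgebra.proj_aeval {k A σ : Type*} [CommRing k] [CommRing A] [Algebra k A]
    (𝒜 : ℕ → Submodule k A) [GradedAlgebra 𝒜] {a : σ → A} {w : σ → ℕ}
    (ha : ∀ i, a i ∈ 𝒜 (w i)) (n : ℕ) (p : MvPolynomial σ k) :
    GradedAlgebra.proj 𝒜 n (aeval a p) = aeval a (weightedHomogeneousComponent w n p) := by
  classical
  induction p using MvPolynomial.induction_on' with
  | add p q hp hq => simp only [map_add, hp, hq]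
  | monomial d c =>
    have hmem : aeval a (monomial d c) ∈ 𝒜 (Finsupp.weight w d) := by
      rw [aeval_monomial, ← Algebra.smul_def, Finsupp.weight_apply]
      exact Submodule.smul_mem _ _ (SetLike.prod_pow_mem_graded 𝒜 w a d fun i _ ↦ ha i)
    have hd := isWeightedHomogeneous_monomial w d c rfl
    rw [GradedAlgebra.proj_apply]
    by_cases h : Finsupp.weight w d = n
    · subst h
      rw [DirectSum.decompose_of_mem_same 𝒜 hmem, hd.weightedHomogeneousComponent_same]
    · rw [DirectSum.decompose_of_mem_ne 𝒜 hmem h, hd.weightedHomogeneousComponent_ne n (Ne.symm h), map_zero]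

open MvPolynomial in
/-- The homogeneous pieces of an algebra generated by finitely many homogeneous elements of
positive degree are finitely generated modules. -/
theorem GradedAlgebra.finite_of_adjoin_eq_top {k A : Type*} [CommRing k] [CommRing A] [Algebra k A]
    (𝒜 : ℕ → Submodule k A) [GradedAlgebra 𝒜] {s : Finset A}
    (hs : Algebra.adjoin k (s : Set A) = ⊤) (hpos : ∀ x ∈ s, ∃ n ≠ 0, x ∈ 𝒜 n) (n : ℕ) :
    Module.Finite k (𝒜 n) := by
  choose w hw0 hw using fun x : s ↦ hpos x x.2
  have hmap : (weightedHomogeneousSubmodule k w n).map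
      (aeval (R := k) ((↑) : s → A)).toLinearMap = 𝒜 n := by
    apply le_antisymm
    · rintro _ ⟨p, hp, rfl⟩
      have h := GradedAlgebra.proj_aeval 𝒜 hw n p
      rw [((mem_weightedHomogeneousSubmodule k w n p).1 hp).weightedHomogeneousComponent_same,
        GradedAlgebra.proj_apply] at h
      exact h ▸ SetLike.coe_mem _
    · intro x hx
      have hx' : x ∈ Algebra.adjoin k (Set.range ((↑) : s → A)) := by
        simp [hs]
      rw [Algebra.adjoin_range_eq_range_aeval] at hx'
      obtain ⟨p, hp⟩ := hx'
      refine ⟨weightedHomogeneousComponent w n p,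
        weightedHomogeneousComponent_isWeightedHomogeneous n p, ?_⟩
      change aeval _ p = x at hp
      change aeval _ _ = x
      rw [← GradedAlgebra.proj_aeval 𝒜 hw, hp, GradedAlgebra.proj_apply,
        DirectSum.decompose_of_mem_same 𝒜 hx]
  rw [Module.Finite.iff_fg, ← hmap]
  exact (weightedHomogeneousSubmodule_fg k w hw0 n).map _

/-- A finitely generated graded algebra whose degree zero piece consists of scalars is generated
by finitely many homogeneous elements of positive degree. -/
theorem GradedAlgebra.exists_finset_adjoin_eq_top {k A : Type*} [CommRing k] [CommRing A]
    [Algebra k A] [Algebra.FiniteType k A] (𝒜 : ℕ → Submodule k A) [GradedAlgebra 𝒜]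
    (h0 : 𝒜 0 = Submodule.span k {(1 : A)}) :
    ∃ s : Finset A, Algebra.adjoin k (s : Set A) = ⊤ ∧ ∀ x ∈ s, ∃ n ≠ 0, x ∈ 𝒜 n := by
  have : IsScalarTower k (𝒜 0) A := ⟨fun c x y ↦ smul_mul_assoc c (x : A) y⟩
  have : Algebra.FiniteType (𝒜 0) A := .of_restrictScalars_finiteType k (𝒜 0) A
  obtain ⟨s, hs, hpos⟩ := exists_finset_adjoin_eq_top_and_homogeneous_ne_zero 𝒜
  refine ⟨s, Algebra.eq_top_iff.2 fun x ↦ ?_, hpos⟩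
  have hx : x ∈ Algebra.adjoin (𝒜 0) (s : Set A) := hs ▸ Algebra.mem_top
  induction hx using Algebra.adjoin_induction with
  | mem x hx => exact Algebra.subset_adjoin hx
  | algebraMap r =>
    obtain ⟨c, hc⟩ := Submodule.mem_span_singleton.1 (h0 ▸ r.2 : (r : A) ∈ Submodule.span k {1})
    change (r : A) ∈ _
    exact hc ▸ Subalgebra.smul_mem _ (one_mem _) c
  | add x y _ _ hx hy => exact add_mem hx hy
  | mul x y _ _ hx hy => exact mul_mem hx hy

/-- The content of the proof of Lemma 2.2: over a finite field `k`, the set of graded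
`k`-algebra automorphisms of a finitely generated commutative ℕ-graded `k`-algebra `A`
with `A₀ = k` is finite. -/
theorem graded_automorphisms_finite
    (k A : Type*) [Field k] [Finite k] [CommRing A] [Algebra k A]
    (𝒜 : ℕ → Submodule k A) [GradedAlgebra 𝒜]
    (h0 : 𝒜 0 = Submodule.span k {(1 : A)})
    (hfg : ∃ S : Finset A, Algebra.adjoin k (S : Set A) = ⊤) :
    {φ : A ≃ₐ[k] A | ∀ n : ℕ, Submodule.map φ.toLinearMap (𝒜 n) = 𝒜 n}.Finite := by
  have : Algebra.FiniteType k A := ⟨hfg⟩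
  obtain ⟨s, hs, hpos⟩ := GradedAlgebra.exists_finset_adjoin_eq_top 𝒜 h0
  have hfin (n : ℕ) : (𝒜 n : Set A).Finite := by
    have := GradedAlgebra.finite_of_adjoin_eq_top 𝒜 hs hpos n
    exact Set.finite_coe_iff.1 (Module.finite_of_finite k)
  choose w _ hw using fun x : s ↦ hpos x x.2
  refine Set.Finite.of_injOn (f := fun φ (x : s) ↦ φ x)
    (t := Set.univ.pi fun x ↦ (𝒜 (w x) : Set A)) ?_ ?_ (Set.Finite.pi fun x ↦ hfin (w x))
  · intro φ hφ x _
    exact (hφ (w x)).le (Submodule.mem_map_of_mem (hw x))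
  · intro φ _ ψ _ h
    have h' : (φ : A →ₐ[k] A) = ψ :=
      AlgHom.ext_of_adjoin_eq_top hs fun x hx ↦ congrFun h ⟨x, hx⟩
    exact AlgEquiv.coe_toAlgHom_injective h'
end

section
/- Let V be a nonzero finite-dimensional real vector space equipped with a positive definite symmetric bilinear form B (B(x,x) > 0 for all x ≠ 0), and let φ be a linear automorphism of V satisfying B(φ(x), φ(y)) = B(x, y) for all x, y. Assume that the characteristic polynomial of φ has integer coefficients, i.e., it is the image in ℝ[X] of a (monic) polynomial with integer coefficients. Then φ has finite order: there exists m ≥ 1 with φ^m = id. -/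
open Polynomial in
/-- Over an algebraically closed field, `det (q(A))` is determined by `q` and `A.charpoly`. -/
theorem Matrix.det_aeval_eq_prod_roots {K n : Type*} [Field K] [IsAlgClosed K] [Fintype n]
    [DecidableEq n] (A : Matrix n n K) (q : K[X]) :
    (aeval A q).det = q.leadingCoeff ^ Fintype.card n *
      (q.roots.map fun b => (-1) ^ Fintype.card n * A.charpoly.eval b).prod := by
  have hfactor (b : K) :
      (aeval A (X - C b)).det = (-1) ^ Fintype.card n * A.charpoly.eval b := by
    rw [Matrix.eval_charpoly, ← Matrix.det_neg]
    simp [Matrix.algebraMap_eq_diagonal, Matrix.scalar_apply, Pi.algebraMap_def]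
  have hprod (s : Multiset K) : (aeval A (s.map (X - C ·)).prod).det =
      (s.map fun b => (-1) ^ Fintype.card n * A.charpoly.eval b).prod := by
    induction s using Multiset.induction with
    | empty => simp
    | cons b s ih =>
      simp only [Multiset.map_cons, Multiset.prod_cons, map_mul, Matrix.det_mul, hfactor, ih]
  conv_lhs => rw [(IsAlgClosed.splits q).eq_prod_roots]
  rw [map_mul, Matrix.det_mul, hprod, aeval_C, Matrix.algebraMap_eq_diagonal]
  simp

open Polynomial in
theorem Matrix.charpoly_pow_eq_of_charpoly_eq {K m n : Type*} [Field K] [Fintype m]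
    [DecidableEq m] [Fintype n] [DecidableEq n] {A : Matrix m m K} {B : Matrix n n K}
    (h : A.charpoly = B.charpoly) (k : ℕ) : (A ^ k).charpoly = (B ^ k).charpoly := by
  have hcard : Fintype.card m = Fintype.card n := by
    rw [← A.charpoly_natDegree_eq_dim, h, B.charpoly_natDegree_eq_dim]
  let f := algebraMap K (AlgebraicClosure K)
  apply Polynomial.map_injective f f.injective
  have hf : (A.map f).charpoly = (B.map f).charpoly := by
    rw [Matrix.charpoly_map, Matrix.charpoly_map, h]
  rw [← Matrix.charpoly_map, ← Matrix.charpoly_map, Matrix.map_pow, Matrix.map_pow]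
  refine Polynomial.funext fun t => ?_
  have hA := Matrix.det_aeval_eq_prod_roots (A.map f) (C t - X ^ k)
  have hB := Matrix.det_aeval_eq_prod_roots (B.map f) (C t - X ^ k)
  rw [hf, hcard, ← hB] at hA
  simpa [Matrix.eval_charpoly, Matrix.algebraMap_eq_diagonal, Matrix.scalar_apply,
    Pi.algebraMap_def] using hA

open Polynomial in
theorem Polynomial.Monic.exists_matrix_charpoly_eq {R : Type*} [CommRing R] {p : R[X]}
    (hp : p.Monic) :
    ∃ (d : ℕ) (M : Matrix (Fin d) (Fin d) R), M.charpoly = p := by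
  nontriviality R
  let b := (AdjoinRoot.powerBasis' hp).basis
  let M := Algebra.leftMulMatrix b (AdjoinRoot.root p)
  refine ⟨_, M, ?_⟩
  have hroot : aeval (AdjoinRoot.root p) M.charpoly = 0 := by
    apply Algebra.leftMulMatrix_injective b
    rw [← Polynomial.aeval_algHom_apply, map_zero]
    exact M.aeval_self_charpoly
  rw [AdjoinRoot.aeval_eq, AdjoinRoot.mk_eq_zero] at hroot
  exact Polynomial.eq_of_monic_of_dvd_of_natDegree_le hp M.charpoly_monic hroot
    (M.charpoly_natDegree_eq_dim.trans (Fintype.card_fin _)).le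

open Polynomial in
theorem Matrix.trace_pow_mem_range_intCast {K n : Type*} [Field K] [CharZero K] [Fintype n]
    [DecidableEq n] {A : Matrix n n K} {p : ℤ[X]}
    (hA : p.map (Int.castRingHom K) = A.charpoly) (k : ℕ) : ∃ z : ℤ, (A ^ k).trace = z := by
  have hp : p.Monic := Polynomial.monic_of_injective Int.cast_injective
    (hA ▸ A.charpoly_monic)
  obtain ⟨d, M, hM⟩ := hp.exists_matrix_charpoly_eq
  have h : (A ^ k).charpoly = ((M ^ k).map (Int.castRingHom K)).charpoly := by
    rw [Matrix.map_pow]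
    apply Matrix.charpoly_pow_eq_of_charpoly_eq
    rw [Matrix.charpoly_map, hM, hA]
  refine ⟨-(M ^ k).charpoly.nextCoeff, ?_⟩
  rw [Matrix.trace_eq_neg_charpoly_nextCoeff, h, Matrix.charpoly_map,
    Polynomial.nextCoeff_map Int.cast_injective]
  simp

open Filter Topology in
/-- Powers of an orthogonal matrix return arbitrarily close to the identity; closeness is measured
here by the trace. -/
theorem Matrix.exists_trace_pow_gt_of_mem_orthogonalGroup {n : Type*} [Fintype n] [DecidableEq n]
    {A : Matrix n n ℝ} (hA : A ∈ Matrix.orthogonalGroup n ℝ) {ε : ℝ} (hε : 0 < ε) :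
    ∃ k : ℕ, 1 ≤ k ∧ (Fintype.card n : ℝ) - ε < (A ^ k).trace := by
  have hpow (k : ℕ) : A ^ k ∈ Matrix.orthogonalGroup n ℝ := pow_mem hA k
  have hbdd (k : ℕ) : (fun i j => (A ^ k) i j) ∈ Metric.closedBall (0 : n → n → ℝ) 1 := by
    simp only [mem_closedBall_zero_iff, pi_norm_le_iff_of_nonneg zero_le_one]
    exact fun i j => entry_norm_bound_of_unitary (hpow k) i j
  obtain ⟨L, -, s, hs, hL⟩ := tendsto_subseq_of_bounded Metric.isBounded_closedBall hbdd
  have hL' : Tendsto (fun m => A ^ s m) atTop (𝓝 (Matrix.of L)) := hL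
  have htrace : Continuous (Matrix.trace : Matrix n n ℝ → ℝ) := continuous_id.matrix_trace
  have hlim := (htrace.tendsto _).comp (hL'.star.mul hL')
  have hlim' := (htrace.tendsto _).comp
    (hL'.star.mul (hL'.comp (tendsto_add_atTop_nat 1)))
  have hone : Tendsto (fun m => (star (A ^ s m) * A ^ s m).trace) atTop
      (𝓝 (Fintype.card n : ℝ)) := by
    simp only [Unitary.star_mul_self_of_mem (hpow _), Matrix.trace_one, tendsto_const_nhds]
  rw [tendsto_nhds_unique hlim hone] at hlim'
  obtain ⟨m, hm⟩ := (hlim'.eventually (lt_mem_nhds (sub_lt_self _ hε))).exists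
  have hlt : s m < s (m + 1) := hs m.lt_succ_self
  refine ⟨s (m + 1) - s m, by omega, ?_⟩
  have hsplit : star (A ^ s m) * A ^ s (m + 1) = A ^ (s (m + 1) - s m) := by
    conv_lhs => rw [← Nat.add_sub_of_le hlt.le, pow_add, ← mul_assoc,
      Unitary.star_mul_self_of_mem (hpow _), one_mul]
  rw [← hsplit]
  exact hm

theorem Matrix.trace_star_sub_one_mul_sub_one_of_mem_orthogonalGroup {n : Type*}
    [Fintype n] [DecidableEq n] {A : Matrix n n ℝ} (hA : A ∈ Matrix.orthogonalGroup n ℝ) :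
    (star (A - 1) * (A - 1)).trace = 2 * (Fintype.card n - A.trace) := by
  rw [star_sub, star_one, sub_mul, mul_sub, Unitary.star_mul_self_of_mem hA]
  simp [Matrix.trace_sub, Matrix.trace_one, Matrix.star_eq_conjTranspose]
  ring

theorem Matrix.trace_le_card_of_mem_orthogonalGroup {n : Type*} [Fintype n] [DecidableEq n]
    {A : Matrix n n ℝ} (hA : A ∈ Matrix.orthogonalGroup n ℝ) : A.trace ≤ Fintype.card n := by
  have h := Matrix.trace_star_sub_one_mul_sub_one_of_mem_orthogonalGroup hA
  have h0 := (Matrix.posSemidef_conjTranspose_mul_self (A - 1)).trace_nonneg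
  rw [← Matrix.star_eq_conjTranspose] at h0
  linarith

theorem Matrix.eq_one_of_mem_orthogonalGroup_of_trace_eq_card {n : Type*} [Fintype n]
    [DecidableEq n] {A : Matrix n n ℝ} (hA : A ∈ Matrix.orthogonalGroup n ℝ)
    (htr : A.trace = Fintype.card n) : A = 1 := by
  have h := Matrix.trace_star_sub_one_mul_sub_one_of_mem_orthogonalGroup hA
  rw [htr, sub_self, mul_zero, Matrix.star_eq_conjTranspose,
    Matrix.trace_conjTranspose_mul_self_eq_zero_iff] at h
  exact sub_eq_zero.mp h

open Polynomial in
theorem Matrix.exists_pow_eq_one_of_mem_orthogonalGroup {n : Type*} [Fintype n] [DecidableEq n]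
    {A : Matrix n n ℝ} (hA : A ∈ Matrix.orthogonalGroup n ℝ) {p : ℤ[X]}
    (hp : p.map (Int.castRingHom ℝ) = A.charpoly) : ∃ m : ℕ, 1 ≤ m ∧ A ^ m = 1 := by
  obtain ⟨k, hk, hlt⟩ := Matrix.exists_trace_pow_gt_of_mem_orthogonalGroup hA one_pos
  have hAk : A ^ k ∈ Matrix.orthogonalGroup n ℝ := pow_mem hA k
  have hle := Matrix.trace_le_card_of_mem_orthogonalGroup hAk
  obtain ⟨z, hz⟩ := Matrix.trace_pow_mem_range_intCast hp k
  refine ⟨k, hk, Matrix.eq_one_of_mem_orthogonalGroup_of_trace_eq_card hAk ?_⟩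
  rw [hz] at hle hlt ⊢
  have h1 : z ≤ (Fintype.card n : ℤ) := by exact_mod_cast hle
  have h2 : (Fintype.card n : ℤ) - 1 < z := by exact_mod_cast hlt
  have h3 : z = (Fintype.card n : ℤ) := by omega
  rw [h3, Int.cast_natCast]

/-- A linear map preserving a positive definite symmetric form is represented by an orthogonal
matrix in a suitable basis. -/
theorem LinearMap.exists_basis_toMatrix_mem_orthogonalGroup {V : Type*} [AddCommGroup V]
    [Module ℝ V] [FiniteDimensional ℝ V] (B : V →ₗ[ℝ] V →ₗ[ℝ] ℝ)
    (hsymm : ∀ x y : V, B x y = B y x) (hpos : ∀ x : V, x ≠ 0 → 0 < B x x)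
    (f : V →ₗ[ℝ] V) (hf : ∀ x y : V, B (f x) (f y) = B x y) :
    ∃ b : Module.Basis (Fin (Module.finrank ℝ V)) ℝ V,
      LinearMap.toMatrix b b f ∈ Matrix.orthogonalGroup (Fin (Module.finrank ℝ V)) ℝ := by
  let core : InnerProductSpace.Core ℝ V :=
    { inner := fun x y => B x y
      conj_inner_symm := fun x y => hsymm y x
      re_inner_nonneg := fun x => by
        rcases eq_or_ne x 0 with rfl | hx
        · simp
        · exact (hpos x hx).le
      add_left := fun x y z => by simp
      smul_left := fun x y r => by simp
      definite := fun x hx => by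
        by_contra h
        exact (hpos x h).ne' hx }
  let : NormedAddCommGroup V := core.toNormedAddCommGroup
  let : InnerProductSpace ℝ V := InnerProductSpace.ofCore core.toCore
  let b := stdOrthonormalBasis ℝ V
  refine ⟨b.toBasis, ?_⟩
  have hadj : LinearMap.adjoint f * f = 1 := by
    ext x
    refine ext_inner_left ℝ fun y => ?_
    rw [Module.End.mul_apply, LinearMap.adjoint_inner_right]
    exact hf y x
  have hstar :
      star (LinearMap.toMatrixOrthonormal b f) * LinearMap.toMatrixOrthonormal b f = 1 := by
    rw [← map_star, ← map_mul, LinearMap.star_eq_adjoint, hadj, map_one]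
  exact (Matrix.mem_orthogonalGroup_iff' _ _).mpr hstar

/-- The engine of the proof of Proposition 5.1 (Oguiso's observation): an orthogonal
transformation of a nonzero finite-dimensional Euclidean space whose characteristic
polynomial has integer coefficients has finite order. -/
theorem orthogonal_integral_charpoly_finite_order
    (V : Type*) [AddCommGroup V] [Module ℝ V] [FiniteDimensional ℝ V] [Nontrivial V]
    (B : V →ₗ[ℝ] V →ₗ[ℝ] ℝ)
    (hsymm : ∀ x y : V, B x y = B y x)
    (hpos : ∀ x : V, x ≠ 0 → 0 < B x x)
    (φ : V ≃ₗ[ℝ] V)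
    (hφ : ∀ x y : V, B (φ x) (φ y) = B x y)
    (hint : ∃ p : Polynomial ℤ, p.map (Int.castRingHom ℝ) =
      LinearMap.charpoly (φ : V →ₗ[ℝ] V)) :
    ∃ m : ℕ, 1 ≤ m ∧ φ ^ m = 1 := by
  obtain ⟨p, hp⟩ := hint
  obtain ⟨b, hb⟩ := LinearMap.exists_basis_toMatrix_mem_orthogonalGroup B hsymm hpos φ hφ
  rw [← LinearMap.charpoly_toMatrix _ b] at hp
  obtain ⟨m, hm, h⟩ := Matrix.exists_pow_eq_one_of_mem_orthogonalGroup hb hp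
  refine ⟨m, hm, LinearEquiv.toLinearMap_injective ((LinearMap.toMatrix b b).injective ?_)⟩
  have hcoe : ((φ ^ m : V ≃ₗ[ℝ] V) : V →ₗ[ℝ] V) = (φ : V →ₗ[ℝ] V) ^ m :=
    map_pow (LinearEquiv.automorphismGroup.toLinearMapMonoidHom (R := ℝ) (M := V)) φ m
  rw [hcoe, ← LinearMap.toMatrix_pow, h]
  exact (LinearMap.toMatrix_one b).symm
end
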